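/- Let 0 ≤ ξ₁ < ξ₂ ≤ 1, let γ_{ξ₁,ξ₂}↑ be an L²(0,1)-projection of γ onto F⁻¹_{U,[ξ₁,ξ₂]} (a minimizer of the L²(0,1) distance to γ over F⁻¹_{U,[ξ₁,ξ₂]}), and set a_{ξ₁,ξ₂} = ∫₀¹ γ_{ξ₁,ξ₂}↑(u) du and b_{ξ₁,ξ₂} = (∫₀¹ (γ_{ξ₁,ξ₂}↑(u) − a_{ξ₁,ξ₂})² du)^{1/2}. If γ_{ξ₁,ξ₂}↑ is not constant, then h_{ξ₁,ξ₂}↑(u) := μ + σ (γ_{ξ₁,ξ₂}↑(u) − a_{ξ₁,ξ₂})/b_{ξ₁,ξ₂} is a worst-case quantile function for sup_{G ∈ F_{U,[ξ₁,ξ₂]}(μ,σ)} ρ_g(G), i.e. h_{ξ₁,ξ₂}↑ is the quantile function of some G* ∈ F_{U,[ξ₁,ξ₂]}(μ,σ) with ρ_g(G*) = sup_{G ∈ F_{U,[ξ₁,ξ₂]}(μ,σ)} ρ_g(G). -/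

import Mathlib

open MeasureTheory Set Filter

noncomputable section

/-- Left quantile function of a distribution function `G`. -/
def leftQ (G : ℝ → ℝ) (p : ℝ) : ℝ := sInf {x : ℝ | p ≤ G x}

/-- `G` is a cumulative distribution function. -/
def IsCDF (G : ℝ → ℝ) : Prop :=
  Monotone G ∧ (∀ x : ℝ, ContinuousWithinAt G (Ici x) x) ∧
    Tendsto G atBot (nhds 0) ∧ Tendsto G atTop (nhds 1)

/-- `G ∈ M²`: a cdf with finite second moment. -/
def MemM2 (G : ℝ → ℝ) : Prop :=
  IsCDF G ∧ IntegrableOn (fun t => (leftQ G t) ^ 2) (Ioo (0:ℝ) 1)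

/-- Mean of `f(V)` for `V` uniform on `(0,1)`. -/
def mean01 (f : ℝ → ℝ) : ℝ := ∫ t in Ioo (0:ℝ) 1, f t

/-- Variance of `f(V)` for `V` uniform on `(0,1)`. -/
def var01 (f : ℝ → ℝ) : ℝ := ∫ t in Ioo (0:ℝ) 1, (f t - mean01 f) ^ 2

/-- Covariance of `f(V)` and `h(V)` for `V` uniform on `(0,1)`. -/
def cov01 (f h : ℝ → ℝ) : ℝ := ∫ t in Ioo (0:ℝ) 1, (f t - mean01 f) * (h t - mean01 h)

/-- Pearson correlation of `f(V)` and `h(V)` for `V` uniform on `(0,1)`. -/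
def corr01 (f h : ℝ → ℝ) : ℝ := cov01 f h / (Real.sqrt (var01 f) * Real.sqrt (var01 h))

/-- Standard deviation of `f(V)` for `V` uniform on `(0,1)`. -/
def sd01 (f : ℝ → ℝ) : ℝ := Real.sqrt (var01 f)

/-- `L²(0,1)` norm. -/
def l2norm (f : ℝ → ℝ) : ℝ := Real.sqrt (∫ u in Ioo (0:ℝ) 1, (f u) ^ 2)

/-- Distortion risk metric expressed via the quantile function:
`ρ_g(h) = ∫₀¹ γ(u) h(u) du` where `γ` is the weight function of `g`. -/
def rhoQ (γ h : ℝ → ℝ) : ℝ := ∫ u in Ioo (0:ℝ) 1, γ u * h u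

/-- `h` belongs to `F⁻¹_{U,ξ}`: it is a quantile function of a unimodal distribution with
inflection point `ξ`, i.e. nondecreasing and continuous on `(0,1)`, concave on `(0,ξ)`,
convex on `(ξ,1)`, and square integrable on `(0,1)`. -/
def UQuant (ξ : ℝ) (h : ℝ → ℝ) : Prop :=
  MonotoneOn h (Ioo (0:ℝ) 1) ∧ ContinuousOn h (Ioo (0:ℝ) 1) ∧
    ConcaveOn ℝ (Ioo (0:ℝ) ξ) h ∧ ConvexOn ℝ (Ioo ξ 1) h ∧
    IntegrableOn (fun t => (h t) ^ 2) (Ioo (0:ℝ) 1)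

/-- `γp` is the `L²(0,1)`-projection of `γ` onto `F⁻¹_{U,ξ}`. -/
def IsProj (ξ : ℝ) (γ γp : ℝ → ℝ) : Prop :=
  UQuant ξ γp ∧ ∀ h : ℝ → ℝ, UQuant ξ h →
    (∫ u in Ioo (0:ℝ) 1, (γ u - γp u) ^ 2) ≤ ∫ u in Ioo (0:ℝ) 1, (γ u - h u) ^ 2

/-- `G ∈ F_{U,ξ}`: `G` is a unimodal cdf in `M²` with inflection point `ξ`. -/
def UnimodalCDF (ξ : ℝ) (G : ℝ → ℝ) : Prop :=
  MemM2 G ∧ ContinuousOn (leftQ G) (Ioo (0:ℝ) 1) ∧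
    ConcaveOn ℝ (Ioo (0:ℝ) ξ) (leftQ G) ∧ ConvexOn ℝ (Ioo ξ 1) (leftQ G)

/-- `F_{U,ξ}(μ,σ)`. -/
def FUset (ξ μ σ : ℝ) : Set (ℝ → ℝ) :=
  {G | UnimodalCDF ξ G ∧ mean01 (leftQ G) = μ ∧
    mean01 (fun t => (leftQ G t) ^ 2) = μ ^ 2 + σ ^ 2}

/-- `F_{U,ξ}(μ,σ,ε)`: additionally within 2-Wasserstein distance `√ε` of `F`. -/
def FUEset (ξ : ℝ) (F : ℝ → ℝ) (μ σ ε : ℝ) : Set (ℝ → ℝ) :=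
  {G | G ∈ FUset ξ μ σ ∧
    Real.sqrt (∫ t in Ioo (0:ℝ) 1, (leftQ F t - leftQ G t) ^ 2) ≤ Real.sqrt ε}

/-- `F_{U,[ξ₁,ξ₂]}(μ,σ)`: unimodal with some inflection point in `[ξ₁,ξ₂]`. -/
def FUIset (ξ₁ ξ₂ μ σ : ℝ) : Set (ℝ → ℝ) :=
  {G | (∃ ξ ∈ Icc ξ₁ ξ₂, UnimodalCDF ξ G) ∧ mean01 (leftQ G) = μ ∧
    mean01 (fun t => (leftQ G t) ^ 2) = μ ^ 2 + σ ^ 2}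

/-- `f` is constant on `(0,1)`. -/
def ConstOn01 (f : ℝ → ℝ) : Prop := ∃ c : ℝ, ∀ t ∈ Ioo (0:ℝ) 1, f t = c


open scoped Pointwise Topology

lemma aestronglyMeasurable_of_left_deriv {g γ : ℝ → ℝ}
    (hgγ : ∀ x ∈ Ioo (0:ℝ) 1, γ (1 - x) = derivWithin g (Iio x) x) :
    AEStronglyMeasurable γ (volume.restrict (Ioo (0:ℝ) 1)) := by
  have key (u : ℝ) :
      derivWithin (fun x => g (1 - x)) (Ioi u) u = -derivWithin g (Iio (1 - u)) (1 - u) := by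
    rw [derivWithin_comp_const_sub]
    congr 2
    ext x
    simp only [mem_vadd_set, Set.mem_neg, mem_Ioi, vadd_eq_add, mem_Iio]
    constructor
    · rintro ⟨y, hy, rfl⟩
      linarith
    · intro hx
      exact ⟨x - 1, by linarith, by ring⟩
  refine (aestronglyMeasurable_derivWithin_Ioi (fun x => g (1 - x)) _).neg.congr ?_
  filter_upwards [ae_restrict_mem measurableSet_Ioo] with u hu
  have h := hgγ (1 - u) ⟨by linarith [hu.2], by linarith [hu.1]⟩
  rw [sub_sub_cancel] at h
  simp [key, h]

instance isProbabilityMeasure_restrict_Ioo_zero_one :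
    IsProbabilityMeasure (volume.restrict (Ioo (0:ℝ) 1)) :=
  ⟨by simp⟩

lemma UQuant.memLp {ξ : ℝ} {h : ℝ → ℝ} (hh : UQuant ξ h) :
    MemLp h 2 (volume.restrict (Ioo (0:ℝ) 1)) :=
  (memLp_two_iff_integrable_sq (hh.2.1.aestronglyMeasurable measurableSet_Ioo)).2 hh.2.2.2.2

lemma UQuant.affine {ξ : ℝ} {h : ℝ → ℝ} (hh : UQuant ξ h) (a : ℝ) {c : ℝ} (hc : 0 ≤ c) :
    UQuant ξ (fun t => a + c * h t) := by
  obtain ⟨h1, h2, h3, h4, -⟩ := id hh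
  refine ⟨fun x hx y hy hxy => ?_, by fun_prop, ?_, ?_, ?_⟩
  · have := mul_le_mul_of_nonneg_left (h1 hx hy hxy) hc
    simpa using this
  · exact (concaveOn_const a h3.1).add (h3.smul hc)
  · exact (convexOn_const a h4.1).add (h4.smul hc)
  · exact ((memLp_const a).add (hh.memLp.const_mul c)).integrable_sq

lemma exists_isCDF_eqOn_leftQ {H : ℝ → ℝ} (hm : MonotoneOn H (Ioo 0 1))
    (hc : ContinuousOn H (Ioo 0 1)) :
    ∃ G : ℝ → ℝ, IsCDF G ∧ EqOn (leftQ G) H (Ioo 0 1) := by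
  have hH : AEMeasurable H (volume.restrict (Ioo (0:ℝ) 1)) := hc.aemeasurable measurableSet_Ioo
  set κ := Measure.map H (volume.restrict (Ioo (0:ℝ) 1)) with hκ
  have : IsProbabilityMeasure κ := Measure.isProbabilityMeasure_map hH
  refine ⟨ProbabilityTheory.cdf κ, ⟨ProbabilityTheory.monotone_cdf κ,
    (ProbabilityTheory.cdf κ).right_continuous, ProbabilityTheory.tendsto_cdf_atBot κ,
    ProbabilityTheory.tendsto_cdf_atTop κ⟩, fun p hp => ?_⟩
  have hval (x : ℝ) : ENNReal.ofReal (ProbabilityTheory.cdf κ x)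
      = volume.restrict (Ioo (0:ℝ) 1) (H ⁻¹' Iic x) := by
    rw [ProbabilityTheory.ofReal_cdf, hκ, Measure.map_apply_of_aemeasurable hH measurableSet_Iic]
  have hset : {x : ℝ | p ≤ ProbabilityTheory.cdf κ x} = Ici (H p) := by
    ext x
    simp only [mem_ofPred_eq, mem_Ici]
    constructor
    · intro hpx
      by_contra! hlt
      have hev : ∀ᶠ q in 𝓝 p, x < H q ∧ q ∈ Ioo (0:ℝ) 1 :=
        ((hc.continuousAt (Ioo_mem_nhds hp.1 hp.2)).eventually (lt_mem_nhds hlt)).and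
          (Ioo_mem_nhds hp.1 hp.2)
      have hleft : ∀ᶠ q in 𝓝[<] p, q < p := self_mem_nhdsWithin
      obtain ⟨q, ⟨hq, hq01⟩, hqp⟩ := ((hev.filter_mono nhdsWithin_le_nhds).and hleft).exists
      have hle : volume.restrict (Ioo (0:ℝ) 1) (H ⁻¹' Iic x) ≤ ENNReal.ofReal q := by
        rw [Measure.restrict_apply₀' measurableSet_Ioo.nullMeasurableSet]
        calc volume (H ⁻¹' Iic x ∩ Ioo 0 1) ≤ volume (Ioo 0 q) := by
              refine measure_mono fun t ht => ⟨ht.2.1, ?_⟩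
              by_contra! hqt
              exact absurd (hm hq01 ht.2 hqt) (not_le.2 (lt_of_le_of_lt ht.1 hq))
          _ = ENNReal.ofReal q := by simp
      rw [← hval] at hle
      have := (ENNReal.ofReal_le_ofReal_iff hq01.1.le).1 hle
      exact absurd (hpx.trans this) (not_le.2 hqp)
    · intro hpx
      have hle : ENNReal.ofReal p ≤ volume.restrict (Ioo (0:ℝ) 1) (H ⁻¹' Iic x) := by
        rw [Measure.restrict_apply₀' measurableSet_Ioo.nullMeasurableSet]
        calc ENNReal.ofReal p = volume (Ioo 0 p) := by simp
          _ ≤ volume (H ⁻¹' Iic x ∩ Ioo 0 1) := by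
              refine measure_mono fun t ht => ?_
              have ht01 : t ∈ Ioo (0:ℝ) 1 := ⟨ht.1, ht.2.trans hp.2⟩
              exact ⟨(hm ht01 hp ht.2.le).trans hpx, ht01⟩
      rw [← hval] at hle
      exact (ENNReal.ofReal_le_ofReal_iff (ProbabilityTheory.cdf_nonneg κ x)).1 hle
  rw [leftQ, hset, csInf_Ici]

lemma IsCDF.monotoneOn_leftQ {G : ℝ → ℝ} (hG : IsCDF G) : MonotoneOn (leftQ G) (Ioo 0 1) := by
  obtain ⟨hm, -, hbot, htop⟩ := hG
  intro p hp q hq hpq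
  refine csInf_le_csInf ?_ ?_ fun x hx => hpq.trans hx
  · obtain ⟨a, ha⟩ := (hbot.eventually (gt_mem_nhds hp.1)).exists
    refine ⟨a, fun x hx => ?_⟩
    by_contra! hxa
    exact absurd (hx.trans (hm hxa.le)) (not_le.2 ha)
  · obtain ⟨a, ha⟩ := (htop.eventually (lt_mem_nhds hq.2)).exists
    exact ⟨a, ha.le⟩

lemma UnimodalCDF.uQuant {ξ : ℝ} {G : ℝ → ℝ} (hG : UnimodalCDF ξ G) : UQuant ξ (leftQ G) :=
  ⟨hG.1.1.monotoneOn_leftQ, hG.2.1, hG.2.2.1, hG.2.2.2, hG.1.2⟩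

lemma UQuant.exists_unimodalCDF {ξ : ℝ} {H : ℝ → ℝ} (hξ₀ : 0 ≤ ξ) (hξ₁ : ξ ≤ 1)
    (hH : UQuant ξ H) : ∃ G, UnimodalCDF ξ G ∧ EqOn (leftQ G) H (Ioo 0 1) := by
  obtain ⟨h1, h2, h3, h4, h5⟩ := hH
  obtain ⟨G, hG, hGH⟩ := exists_isCDF_eqOn_leftQ h1 h2
  refine ⟨G, ⟨⟨hG, ?_⟩, h2.congr hGH, ?_, ?_⟩, hGH⟩
  · exact h5.congr_fun (fun t ht => by simp only [hGH ht]) measurableSet_Ioo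
  · exact h3.congr (hGH.symm.mono (Ioo_subset_Ioo_right hξ₁))
  · exact h4.congr (hGH.symm.mono (Ioo_subset_Ioo_left hξ₀))

lemma mean01_congr {f h : ℝ → ℝ} (hfh : EqOn f h (Ioo 0 1)) : mean01 f = mean01 h :=
  setIntegral_congr_fun measurableSet_Ioo hfh

lemma mean01_affine {h : ℝ → ℝ} (hh : MemLp h 2 (volume.restrict (Ioo (0:ℝ) 1))) (a c : ℝ) :
    mean01 (fun t => a + c * h t) = a + c * mean01 h := by
  have hi := hh.integrable one_le_two
  simp only [mean01]
  rw [integral_add (integrable_const _) (hi.const_mul c), integral_const_mul]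
  simp

lemma mean01_affine_sq {h : ℝ → ℝ} (hh : MemLp h 2 (volume.restrict (Ioo (0:ℝ) 1))) (a c : ℝ) :
    mean01 (fun t => (a + c * h t) ^ 2)
      = a ^ 2 + 2 * a * c * mean01 h + c ^ 2 * mean01 (fun t => h t ^ 2) := by
  have hi := hh.integrable one_le_two
  have hs := hh.integrable_sq
  have h1 : Integrable (fun t => a ^ 2 + 2 * a * c * h t) (volume.restrict (Ioo (0:ℝ) 1)) :=
    (integrable_const _).add (hi.const_mul _)
  have he : (fun t => (a + c * h t) ^ 2)
      = fun t => (a ^ 2 + 2 * a * c * h t) + c ^ 2 * h t ^ 2 := by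
    ext t; ring
  simp only [mean01]
  rw [he, integral_add h1 (hs.const_mul _),
    integral_add (integrable_const _) (hi.const_mul _), integral_const_mul, integral_const_mul]
  simp

lemma var01_eq {h : ℝ → ℝ} (hh : MemLp h 2 (volume.restrict (Ioo (0:ℝ) 1))) :
    var01 h = mean01 (fun t => h t ^ 2) - mean01 h ^ 2 := by
  have := mean01_affine_sq hh (-mean01 h) 1
  have he : var01 h = mean01 (fun t => (-mean01 h + 1 * h t) ^ 2) := by
    simp only [var01]
    conv_rhs => rw [mean01]
    congr 1
    ext t
    ring
  rw [he, this]
  ring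

lemma rhoQ_affine {γ h : ℝ → ℝ} (hγ : MemLp γ 2 (volume.restrict (Ioo (0:ℝ) 1)))
    (hh : MemLp h 2 (volume.restrict (Ioo (0:ℝ) 1))) (a c : ℝ) :
    rhoQ γ (fun t => a + c * h t) = a * mean01 γ + c * rhoQ γ h := by
  have hi := hγ.integrable one_le_two
  have hp : Integrable (fun t => γ t * h t) (volume.restrict (Ioo (0:ℝ) 1)) :=
    hγ.integrable_mul hh
  have he : (fun t => γ t * (a + c * h t)) = fun t => a * γ t + c * (γ t * h t) := by
    ext t; ring
  simp only [rhoQ, mean01]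
  rw [he, integral_add (hi.const_mul _) (hp.const_mul _), integral_const_mul, integral_const_mul]

lemma integral_sub_sq_eq {γ h : ℝ → ℝ} (hγ : MemLp γ 2 (volume.restrict (Ioo (0:ℝ) 1)))
    (hh : MemLp h 2 (volume.restrict (Ioo (0:ℝ) 1))) :
    ∫ u in Ioo (0:ℝ) 1, (γ u - h u) ^ 2
      = mean01 (fun t => γ t ^ 2) - 2 * rhoQ γ h + mean01 (fun t => h t ^ 2) := by
  have hp : Integrable (fun t => γ t * h t) (volume.restrict (Ioo (0:ℝ) 1)) :=
    hγ.integrable_mul hh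
  have h1 : Integrable (fun t => γ t ^ 2 - 2 * (γ t * h t)) (volume.restrict (Ioo (0:ℝ) 1)) :=
    hγ.integrable_sq.sub (hp.const_mul _)
  have he : (fun t => (γ t - h t) ^ 2) = fun t => (γ t ^ 2 - 2 * (γ t * h t)) + h t ^ 2 := by
    ext t; ring
  simp only [rhoQ, mean01]
  rw [he, integral_add h1 hh.integrable_sq,
    integral_sub hγ.integrable_sq (hp.const_mul _), integral_const_mul]

lemma UQuant.sd01_pos {ξ : ℝ} {h : ℝ → ℝ} (hh : UQuant ξ h) (hnc : ¬ ConstOn01 h) :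
    0 < sd01 h := by
  have hnn : 0 ≤ var01 h := integral_nonneg fun t => sq_nonneg _
  refine Real.sqrt_pos.2 (lt_of_le_of_ne hnn fun h0 => hnc ⟨mean01 h, fun t ht => ?_⟩)
  have hint : Integrable (fun t => (h t - mean01 h) ^ 2) (volume.restrict (Ioo (0:ℝ) 1)) :=
    (hh.memLp.sub (memLp_const _)).integrable_sq
  have hz := (integral_eq_zero_iff_of_nonneg (fun t => sq_nonneg _) hint).1 h0.symm
  have hae : h =ᵐ[volume.restrict (Ioo (0:ℝ) 1)] fun _ => mean01 h := by
    filter_upwards [hz] with t ht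
    simpa [sub_eq_zero] using ht
  exact Measure.eqOn_open_of_ae_eq hae isOpen_Ioo hh.2.1 continuousOn_const ht

theorem stmt_19 (ξ₁ ξ₂ μ σ : ℝ) (h₁ : 0 ≤ ξ₁) (h₂ : ξ₁ < ξ₂) (h₃ : ξ₂ ≤ 1) (hσ : 0 < σ)
    (g γ : ℝ → ℝ) (hγ2 : IntegrableOn (fun u => (γ u) ^ 2) (Ioo (0:ℝ) 1))
    (hg0 : g 0 = 0)
    (hgγ : ∀ x ∈ Ioo (0:ℝ) 1, γ (1 - x) = derivWithin g (Iio x) x)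
    (γp : ℝ → ℝ)
    (hproj : (∃ ξ ∈ Icc ξ₁ ξ₂, UQuant ξ γp) ∧
      ∀ h : ℝ → ℝ, (∃ ξ ∈ Icc ξ₁ ξ₂, UQuant ξ h) →
        (∫ u in Ioo (0:ℝ) 1, (γ u - γp u) ^ 2)
          ≤ ∫ u in Ioo (0:ℝ) 1, (γ u - h u) ^ 2)
    (hnc : ¬ ConstOn01 γp) :
    ∃ G ∈ FUIset ξ₁ ξ₂ μ σ,
      (∀ t ∈ Ioo (0:ℝ) 1, leftQ G t = μ + σ * (γp t - mean01 γp) / sd01 γp) ∧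
      ∀ G' ∈ FUIset ξ₁ ξ₂ μ σ, rhoQ γ (leftQ G') ≤ rhoQ γ (leftQ G) := by
  obtain ⟨⟨ξ, hξ, hp⟩, hmin⟩ := hproj
  have hγ : MemLp γ 2 (volume.restrict (Ioo (0:ℝ) 1)) :=
    (memLp_two_iff_integrable_sq (aestronglyMeasurable_of_left_deriv hgγ)).2 hγ2
  have hb : 0 < sd01 γp := hp.sd01_pos hnc
  have hb2 : sd01 γp ^ 2 = mean01 (fun t => γp t ^ 2) - mean01 γp ^ 2 := by
    rw [← var01_eq hp.memLp]
    exact Real.sq_sqrt (integral_nonneg fun t => sq_nonneg _)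
  set a := mean01 γp
  set b := sd01 γp
  have hHe (t : ℝ) : μ + σ * (γp t - a) / b = (μ - σ * a / b) + σ / b * γp t := by ring
  obtain ⟨G, hG, hGH⟩ :=
    (hp.affine (μ - σ * a / b) (div_pos hσ hb).le).exists_unimodalCDF (h₁.trans hξ.1)
      (hξ.2.trans h₃)
  refine ⟨G, ⟨⟨ξ, hξ, hG⟩, ?_, ?_⟩, fun t ht => (hGH ht).trans (hHe t).symm, ?_⟩
  · rw [mean01_congr hGH, mean01_affine hp.memLp]
    change μ - σ * a / b + σ / b * a = μ
    ring
  · rw [mean01_congr (h := fun t => (μ - σ * a / b + σ / b * γp t) ^ 2)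
      (fun t ht => by simp only [hGH ht]), mean01_affine_sq hp.memLp]
    rw [show mean01 (fun t => γp t ^ 2) = a ^ 2 + b ^ 2 by linarith]
    change _ + _ * a + _ = _
    field_simp
    ring
  · rintro G' ⟨⟨ξ', hξ', hG'⟩, hm, hs⟩
    have hq := hG'.uQuant
    have hα := hq.affine (a - b / σ * μ) (div_pos hb hσ).le
    have hle := hmin _ ⟨ξ', hξ', hα⟩
    rw [integral_sub_sq_eq hγ hp.memLp, integral_sub_sq_eq hγ hα.memLp,
      mean01_affine_sq hq.memLp, hm, hs, rhoQ_affine hγ hq.memLp] at hle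
    have hnorm : (a - b / σ * μ) ^ 2 + 2 * (a - b / σ * μ) * (b / σ) * μ
        + (b / σ) ^ 2 * (μ ^ 2 + σ ^ 2) = a ^ 2 + b ^ 2 := by
      field_simp
      ring
    have hrho : rhoQ γ (leftQ G) = rhoQ γ (fun t => μ - σ * a / b + σ / b * γp t) :=
      setIntegral_congr_fun measurableSet_Ioo fun t ht => by simp only [hGH ht]
    rw [hrho, rhoQ_affine hγ hp.memLp]
    have hle' : (a - b / σ * μ) * mean01 γ + b / σ * rhoQ γ (leftQ G') ≤ rhoQ γ γp := by
      linarith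
    have := mul_le_mul_of_nonneg_left hle' (div_pos hσ hb).le
    have he : σ / b * ((a - b / σ * μ) * mean01 γ + b / σ * rhoQ γ (leftQ G'))
        = (σ * a / b - μ) * mean01 γ + rhoQ γ (leftQ G') := by
      field_simp
    linarith

end
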